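/- Let G be 3-edge-connected with DFS tree T rooted at r. For any two distinct vertices v ≠ v', the sets U(v) and U(v') are disjoint; equivalently, for every vertex u there is at most one ancestor v ≠ r of u for which there exists a back-edge e with B(u) = B(v) ⊔ {e}. -/

import Mathlib

/-- An undirected multigraph `G` (parallel edges allowed, no self-loops) together with a
DFS spanning tree `T` rooted at `root`, where the vertices are identified with their DFS
preorder numbers (so they are `Fin n`, and the root gets the smallest number).
Tree edges are oriented from child to parent and back-edges from descendant to
(proper) ancestor. -/
structure DFSGraph where
  /-- number of vertices; the vertices are `Fin n`, numbered in DFS preorder -/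
  n : ℕ
  /-- the type indexing the edges (parallel edges are allowed) -/
  Edge : Type
  edgeFintype : Fintype Edge
  /-- the first endpoint (the descendant end) of each edge -/
  fst : Edge → Fin n
  /-- the second endpoint (the ancestor end) of each edge -/
  snd : Edge → Fin n
  /-- no self-loops -/
  noloop : ∀ e, fst e ≠ snd e
  /-- the root `r` of the DFS tree -/
  root : Fin n
  /-- in DFS preorder the root gets the smallest number -/
  root_le : ∀ v, root ≤ v
  /-- the parent function `p` of the DFS tree (arbitrary at the root) -/
  parent : Fin n → Fin n
  /-- the parent of a non-root vertex precedes it in preorder -/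
  parent_lt : ∀ v, v ≠ root → parent v < v
  /-- `tEdge v` is the tree edge `(v, p(v))`, for `v ≠ root` -/
  tEdge : Fin n → Edge
  tEdge_fst : ∀ v, v ≠ root → fst (tEdge v) = v
  tEdge_snd : ∀ v, v ≠ root → snd (tEdge v) = parent v
  tEdge_inj : ∀ u v, u ≠ root → v ≠ root → tEdge u = tEdge v → u = v
  /-- DFS property: every non-tree edge is a back-edge, i.e. it joins a vertex to an
  ancestor of it (a proper ancestor, by `noloop`) -/
  back_anc : ∀ e, (¬ ∃ v, v ≠ root ∧ e = tEdge v) →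
    Relation.ReflTransGen (fun x y => x ≠ root ∧ y = parent x) (fst e) (snd e)
  /-- preorder property: the descendants of any vertex form an interval of preorder
  numbers starting at that vertex -/
  preorder_interval : ∀ v u w : Fin n, v ≤ u → u ≤ w →
    Relation.ReflTransGen (fun x y => x ≠ root ∧ y = parent x) w v →
    Relation.ReflTransGen (fun x y => x ≠ root ∧ y = parent x) u v

namespace DFSGraph

variable (G : DFSGraph)

/-- `Anc a b`: `a` is an ancestor of `b` in `T` (every vertex is an ancestor of itself). -/
def Anc (a b : Fin G.n) : Prop :=
  Relation.ReflTransGen (fun x y => x ≠ G.root ∧ y = G.parent x) b a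

/-- `PAnc a b`: `a` is a proper ancestor of `b` in `T`. -/
def PAnc (a b : Fin G.n) : Prop := G.Anc a b ∧ a ≠ b

/-- `e` is an edge of the spanning tree `T`. -/
def IsTreeEdge (e : G.Edge) : Prop := ∃ v, v ≠ G.root ∧ e = G.tEdge v

/-- `e` is a back-edge (an edge of `G ∖ T`). -/
def IsBack (e : G.Edge) : Prop := ¬ G.IsTreeEdge e

/-- `B v`: the set of back-edges `(x, y)` with `x` a descendant of `v` and `y` a proper
ancestor of `v`. -/
def B (v : Fin G.n) : Set G.Edge :=
  {e | G.IsBack e ∧ G.Anc v (G.fst e) ∧ G.PAnc (G.snd e) v}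

/-- `b_count(v) = |B(v)|`. -/
noncomputable def bcount (v : Fin G.n) : ℕ := (G.B v).ncard

/-- adjacency in `G` after removing the edge set `S` -/
def AdjOff (S : Set G.Edge) (x y : Fin G.n) : Prop :=
  ∃ e, e ∉ S ∧ ((G.fst e = x ∧ G.snd e = y) ∨ (G.fst e = y ∧ G.snd e = x))

/-- `G ∖ S` is connected -/
def ConnectedOff (S : Set G.Edge) : Prop :=
  ∀ x y, Relation.ReflTransGen (G.AdjOff S) x y

/-- `S` is an edge cut of `G`: removing `S` disconnects `G`. -/
def IsCut (S : Set G.Edge) : Prop := ¬ G.ConnectedOff S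

/-- `G` is `k`-edge-connected: it has no cut of fewer than `k` edges. -/
def EdgeConn (k : ℕ) : Prop := ∀ S : Set G.Edge, S.ncard < k → ¬ G.IsCut S

/-- `IsLow1 v y`: `y = low1(v) = min {y | ∃ (x,y) ∈ B(v)}`. -/
def IsLow1 (v y : Fin G.n) : Prop :=
  (∃ e ∈ G.B v, G.snd e = y) ∧ ∀ e ∈ G.B v, y ≤ G.snd e

/-- `IsHigh v y`: `y = high(v) = max {y | ∃ (x,y) ∈ B(v)}`. -/
def IsHigh (v y : Fin G.n) : Prop :=
  (∃ e ∈ G.B v, G.snd e = y) ∧ ∀ e ∈ G.B v, G.snd e ≤ y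

/-- `IsLow2 v y`: `y = low2(v)`, the minimum lower end of the back-edges in `B(v)` minus
one (fixed, but arbitrary) back-edge `(low1D(v), low1(v))` attaining `low1(v)`. -/
def IsLow2 (v y : Fin G.n) : Prop :=
  ∃ f ∈ G.B v, (∀ g ∈ G.B v, G.snd f ≤ G.snd g) ∧
    (∃ e ∈ G.B v, e ≠ f ∧ G.snd e = y) ∧
    (∀ e ∈ G.B v, e ≠ f → y ≤ G.snd e)

/-- `IsL1 v y`: `y = l1(v) = min ({y | (v,y) is a back-edge} ∪ {v})`. -/
def IsL1 (v y : Fin G.n) : Prop :=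
  (y = v ∨ ∃ e, G.IsBack e ∧ G.fst e = v ∧ G.snd e = y) ∧
  y ≤ v ∧ (∀ e, G.IsBack e → G.fst e = v → y ≤ G.snd e)

/-- `IsL2 v y`: `y = l2(v)`, defined as `l1(v)` but after removing one (fixed, but
arbitrary) back-edge `(v, l1(v))` attaining `l1(v)`, if such a back-edge exists. -/
def IsL2 (v y : Fin G.n) : Prop :=
  ((¬ ∃ e, G.IsBack e ∧ G.fst e = v) ∧ y = v) ∨
  (∃ f, G.IsBack f ∧ G.fst f = v ∧
    (∀ g, G.IsBack g → G.fst g = v → G.snd f ≤ G.snd g) ∧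
    (y = v ∨ ∃ e, G.IsBack e ∧ G.fst e = v ∧ e ≠ f ∧ G.snd e = y) ∧
    y ≤ v ∧
    (∀ e, G.IsBack e → G.fst e = v → e ≠ f → y ≤ G.snd e))

/-- `z` is the nearest common ancestor of the set of vertices `S`. -/
def IsNCA (S : Set (Fin G.n)) (z : Fin G.n) : Prop :=
  (∀ x ∈ S, G.Anc z x) ∧ ∀ z', (∀ x ∈ S, G.Anc z' x) → G.Anc z' z

/-- `IsM v m`: `m = M(v)`, the nearest common ancestor of all higher ends of back-edges
in `B(v)`. -/
def IsM (v m : Fin G.n) : Prop :=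
  G.IsNCA {x | ∃ e ∈ G.B v, G.fst e = x} m

/-- `IsMtilde v m`: `m = M̃(v)`, the nearest common ancestor of all higher ends of
back-edges in `B(v)` that are proper descendants of `M(v)` (defined only if such a
higher end exists). -/
def IsMtilde (v m : Fin G.n) : Prop :=
  ∃ mv, G.IsM v mv ∧
    {x | ∃ e ∈ G.B v, G.fst e = x ∧ G.PAnc mv x}.Nonempty ∧
    G.IsNCA {x | ∃ e ∈ G.B v, G.fst e = x ∧ G.PAnc mv x} m

/-- `c` is a child of `p` in `T`. -/
def IsChild (p c : Fin G.n) : Prop := c ≠ G.root ∧ G.parent c = p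

/-- `low1(c) ≤ low1(c')` (stated relationally). -/
def Low1LE (c c' : Fin G.n) : Prop :=
  ∀ y y', G.IsLow1 c y → G.IsLow1 c' y' → y ≤ y'

/-- `c = c₁(p)`: `c` is a `low1` child of `p`, i.e. a child of `p` minimizing `low1`. -/
def IsC1 (p c : Fin G.n) : Prop :=
  G.IsChild p c ∧ ∀ c', G.IsChild p c' → G.Low1LE c c'

/-- `c = c₂(p)`: `c` is a `low2` child of `p`, i.e. a child of `p` minimizing `low1`
among the children different from the (fixed) `low1` child. -/
def IsC2 (p c : Fin G.n) : Prop :=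
  ∃ c1, G.IsC1 p c1 ∧ G.IsChild p c ∧ c ≠ c1 ∧
    ∀ c', G.IsChild p c' → c' ≠ c1 → G.Low1LE c c'

/-- `c = c₃(p)`: `c` is a `low3` child of `p`. -/
def IsC3 (p c : Fin G.n) : Prop :=
  ∃ c1 c2, G.IsC1 p c1 ∧
    (G.IsChild p c2 ∧ c2 ≠ c1 ∧ ∀ c', G.IsChild p c' → c' ≠ c1 → G.Low1LE c2 c') ∧
    G.IsChild p c ∧ c ≠ c1 ∧ c ≠ c2 ∧
    (∀ c', G.IsChild p c' → c' ≠ c1 → c' ≠ c2 → G.Low1LE c c')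

/-- `IsMlow1 v m`: `m = M_low1(v)`, the nearest common ancestor of all higher ends of
back-edges in `B(v)` that are descendants of the `low1` child of `M(v)` (defined only
if such a higher end exists). -/
def IsMlow1 (v m : Fin G.n) : Prop :=
  ∃ mv c1, G.IsM v mv ∧ G.IsC1 mv c1 ∧
    {x | ∃ e ∈ G.B v, G.fst e = x ∧ G.Anc c1 x}.Nonempty ∧
    G.IsNCA {x | ∃ e ∈ G.B v, G.fst e = x ∧ G.Anc c1 x} m

/-- `IsMlow2 v m`: `m = M_low2(v)`, the nearest common ancestor of all higher ends of
back-edges in `B(v)` that are descendants of the `low2` child of `M(v)` (defined only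
if such a higher end exists). -/
def IsMlow2 (v m : Fin G.n) : Prop :=
  ∃ mv c2, G.IsM v mv ∧ G.IsC2 mv c2 ∧
    {x | ∃ e ∈ G.B v, G.fst e = x ∧ G.Anc c2 x}.Nonempty ∧
    G.IsNCA {x | ∃ e ∈ G.B v, G.fst e = x ∧ G.Anc c2 x} m

/-- `IsNextM v w`: `w = nextM(v)`, the maximum vertex `w < v` with `M(w) = M(v)`. -/
def IsNextM (v w : Fin G.n) : Prop :=
  ∃ m, G.IsM v m ∧ G.IsM w m ∧ w < v ∧ ∀ w', w' < v → G.IsM w' m → w' ≤ w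

/-- `IsLowM v l`: `l = low_M(v) = min {y | ∃ (x,y) ∈ B(v) ∖ B(nextM(v))}`. -/
def IsLowM (v l : Fin G.n) : Prop :=
  ∃ w, G.IsNextM v w ∧ (∃ e ∈ G.B v, e ∉ G.B w ∧ G.snd e = l) ∧
    ∀ e ∈ G.B v, e ∉ G.B w → l ≤ G.snd e

end DFSGraph
namespace DFSGraph

variable {G : DFSGraph} {a b c u v w : Fin G.n} {e : G.Edge}

lemma Anc.trans (h : G.Anc a b) (h' : G.Anc b c) : G.Anc a c :=
  Relation.ReflTransGen.trans h' h

lemma Anc.le (h : G.Anc a b) : a ≤ b := by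
  induction h with
  | refl => exact le_rfl
  | tail _ h ih => exact (h.2 ▸ (G.parent_lt _ h.1).le).trans ih

lemma Anc.antisymm (h : G.Anc a b) (h' : G.Anc b a) : a = b :=
  le_antisymm h.le h'.le

lemma Anc.total (h : G.Anc a c) (h' : G.Anc b c) : G.Anc a b ∨ G.Anc b a :=
  (Relation.ReflTransGen.total_of_right_unique
    (fun _ _ _ hy hz => hy.2.trans hz.2.symm) h h').symm

lemma anc_parent_iff (hw : w ≠ G.root) (ha : w ≠ a) : G.Anc a (G.parent w) ↔ G.Anc a w := by
  refine ⟨fun h => Relation.ReflTransGen.head ⟨hw, rfl⟩ h, fun h => ?_⟩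
  rcases Relation.ReflTransGen.cases_head h with h | ⟨x, ⟨_, rfl⟩, h⟩
  · exact absurd h ha
  · exact h

lemma IsBack.anc (h : G.IsBack e) : G.Anc (G.snd e) (G.fst e) :=
  G.back_anc e h

/-- A back-edge leaves the subtree of `v` exactly when it belongs to `B v`. -/
lemma IsBack.mem_B_iff (h : G.IsBack e) :
    e ∈ G.B v ↔ G.Anc v (G.fst e) ∧ ¬ G.Anc v (G.snd e) := by
  refine ⟨fun ⟨_, hf, hs, hne⟩ => ⟨hf, fun h' => hne (hs.antisymm h')⟩,
    fun ⟨hf, hs⟩ => ⟨h, hf, ?_, ?_⟩⟩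
  · exact (hf.total h.anc).resolve_left hs
  · rintro rfl
    exact hs .refl

/-- A back-edge in `B u ∩ B w` belongs to `B v` for every `v` on the tree path from `u` to `w`. -/
lemma mem_B_of_between (hwv : G.Anc w v) (hvu : G.Anc v u) (hu : e ∈ G.B u) (hw : e ∈ G.B w) :
    e ∈ G.B v :=
  ⟨hu.1, hvu.trans hu.2.1, hw.2.2.1.trans hwv,
    fun h => hw.2.2.2 (hw.2.2.1.antisymm (h ▸ hwv))⟩

/-- If `B v = B w` for a proper ancestor `w ≠ r` of `v`, then the tree edges of `v` and `w`
form a cut. -/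
lemma isCut_pair_of_B_eq (hw : w ≠ G.root) (hwv : G.PAnc w v)
    (hB : G.B v = G.B w) : G.IsCut {G.tEdge v, G.tEdge w} := by
  intro hconn
  have key : ∀ e ∉ ({G.tEdge v, G.tEdge w} : Set G.Edge),
      (G.Anc w (G.fst e) ∧ ¬ G.Anc v (G.fst e)) ↔
        (G.Anc w (G.snd e) ∧ ¬ G.Anc v (G.snd e)) := by
    intro e he
    simp only [Set.mem_insert_iff, Set.mem_singleton_iff, not_or] at he
    by_cases ht : G.IsTreeEdge e
    · obtain ⟨x, hx, rfl⟩ := ht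
      rw [G.tEdge_fst x hx, G.tEdge_snd x hx,
        anc_parent_iff hx (fun h => he.2 (h ▸ rfl)), anc_parent_iff hx (fun h => he.1 (h ▸ rfl))]
    · have hb : G.IsBack e := ht
      have h1 := hb.mem_B_iff (v := v)
      have h2 := hb.mem_B_iff (v := w)
      have h3 : G.Anc v (G.snd e) → G.Anc v (G.fst e) := fun h => h.trans hb.anc
      have h4 : G.Anc w (G.snd e) → G.Anc w (G.fst e) := fun h => h.trans hb.anc
      rw [hB] at h1
      tauto
  have stay : ∀ x, Relation.ReflTransGen (G.AdjOff {G.tEdge v, G.tEdge w}) w x →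
      G.Anc w x ∧ ¬ G.Anc v x := by
    intro x hx
    induction hx with
    | refl => exact ⟨.refl, fun h => hwv.2 (hwv.1.antisymm h)⟩
    | tail _ h ih =>
      obtain ⟨e, he, ⟨rfl, rfl⟩ | ⟨rfl, rfl⟩⟩ := h
      · exact (key e he).1 ih
      · exact (key e he).2 ih
  exact hw (le_antisymm (stay _ (hconn w G.root)).1.le (G.root_le w))

lemma EdgeConn.B_ne (h3 : G.EdgeConn 3) (hw : w ≠ G.root) (hwv : G.PAnc w v) :
    G.B v ≠ G.B w := fun hB =>
  h3 _ ((Set.ncard_insert_le _ _).trans_lt (by simp)) (isCut_pair_of_B_eq hw hwv hB)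

lemma EdgeConn.eq_of_anc_of_B_eq_insert (h3 : G.EdgeConn 3) {e e' : G.Edge}
    (hw : w ≠ G.root) (hwv : G.Anc w v) (hvu : G.Anc v u)
    (he : e ∉ G.B v) (hBv : G.B u = insert e (G.B v))
    (he' : e' ∉ G.B w) (hBw : G.B u = insert e' (G.B w)) : v = w := by
  by_contra hne
  have heu : e ∈ G.B u := hBv ▸ Set.mem_insert _ _
  have hee : e = e' := (hBw ▸ heu : e ∈ insert e' (G.B w)).resolve_right
    fun h => he (mem_B_of_between hwv hvu heu h)
  subst hee
  refine h3.B_ne hw ⟨hwv, Ne.symm hne⟩ ?_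
  rw [← Set.insert_sdiff_self_of_notMem he, ← hBv, hBw, Set.insert_sdiff_self_of_notMem he']

end DFSGraph

/-- Let `G` be `3`-edge-connected with DFS tree `T` rooted at `r`. For
any two distinct vertices `v ≠ v'` the sets `U(v)` and `U(v')` are disjoint;
equivalently, for every vertex `u` there is at most one ancestor `v ≠ r` of `u` for
which there exists a back-edge `e` with `B(u) = B(v) ⊔ {e}`. -/
theorem stmt5 (G : DFSGraph) (h3 : G.EdgeConn 3) (u v v' : Fin G.n)
    (hv : v ≠ G.root) (hv' : v' ≠ G.root)
    (h1 : G.Anc v u ∧ ∃ e, G.IsBack e ∧ e ∉ G.B v ∧ G.B u = insert e (G.B v))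
    (h2 : G.Anc v' u ∧ ∃ e, G.IsBack e ∧ e ∉ G.B v' ∧ G.B u = insert e (G.B v')) :
    v = v' := by
  obtain ⟨hvu, e, _, he, hB⟩ := h1
  obtain ⟨hvu', e', _, he', hB'⟩ := h2
  rcases hvu.total hvu' with h | h
  · exact (h3.eq_of_anc_of_B_eq_insert hv h hvu' he' hB' he hB).symm
  · exact h3.eq_of_anc_of_B_eq_insert hv' h hvu he hB he' hB'
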